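/- Fix κ ∈ (4,8), N ≥ 1, and an odd index j ∈ {1,3,…,2N−1} (so that {j,j+1} is a link of ⌢⌢^{(N)}). Fix points x_1 < ⋯ < x_{j−1} < x_{j+2} < ⋯ < x_{2N} and ξ ∈ (x_{j−1}, x_{j+2}) (with the conventions x_0 = −∞, x_{2N+1} = +∞). Then, in the limit as x_j and x_{j+1} both tend to ξ subject to x_{j−1} < x_j < x_{j+1} < x_{j+2}, one has G^{(N)}(x_1,…,x_{2N}) / (x_{j+1}−x_j)^{−2h(κ)} → √(q(κ)) · G^{(N−1)}(ẍ_j), where ẍ_j := (x_1,…,x_{j−1},x_{j+2},…,x_{2N}) ∈ 𝔛_{2N−2}. -/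

import Mathlib

open Filter Topology MeasureTheory

noncomputable section

/-- The conformal weight `h(κ) = (6-κ)/(2κ)`. -/
def hexp (κ : ℝ) : ℝ := (6 - κ) / (2 * κ)

/-- The cluster weight `q(κ) = 4 cos²(4π/κ)`. -/
def qexp (κ : ℝ) : ℝ := 4 * Real.cos (4 * Real.pi / κ) ^ 2

/-- The normalizing constant `c(κ) = √(q(κ)) Γ(2-8/κ) / Γ(1-4/κ)²`. -/
def cgConst (κ : ℝ) : ℝ :=
  Real.sqrt (qexp κ) * Real.Gamma (2 - 8 / κ) / Real.Gamma (1 - 4 / κ) ^ 2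

/-- The index of `x_{2r-1}` (1-indexed), i.e. `2r` (0-indexed). -/
def idxA (N : ℕ) (r : Fin N) : Fin (2 * N) := ⟨2 * r.val, by have := r.isLt; omega⟩

/-- The index of `x_{2r}` (1-indexed), i.e. `2r+1` (0-indexed). -/
def idxB (N : ℕ) (r : Fin N) : Fin (2 * N) := ⟨2 * r.val + 1, by have := r.isLt; omega⟩

/-- The Coulomb gas integrand
`∏_{r<s} (u_s-u_r)^{8/κ} ∏_{r,i} |u_r - x_i|^{-4/κ}`. -/
def cgIntegrand (κ : ℝ) (N : ℕ) (x : Fin (2 * N) → ℝ) (u : Fin N → ℝ) : ℝ :=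
  (∏ r : Fin N, ∏ s : Fin N, if r < s then (u s - u r) ^ (8 / κ) else 1) *
    ∏ r : Fin N, ∏ i : Fin (2 * N), |u r - x i| ^ (-(4 / κ))

/-- The integration domain: the open box `∏_r (x_{2r-1}, x_{2r})`. -/
def cgBox (N : ℕ) (x : Fin (2 * N) → ℝ) : Set (Fin N → ℝ) :=
  Set.univ.pi fun r => Set.Ioo (x (idxA N r)) (x (idxB N r))

/-- The Coulomb gas integral `G^{(N)}` associated to the completely unnested
link pattern `⌢⌢^{(N)} = {{1,2},…,{2N-1,2N}}`. -/
def cgG (κ : ℝ) (N : ℕ) (x : Fin (2 * N) → ℝ) : ℝ :=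
  cgConst κ ^ N
    * (∏ i : Fin (2 * N), ∏ k : Fin (2 * N), if i < k then (x k - x i) ^ (2 / κ) else 1)
    * ∫ u in cgBox N x, cgIntegrand κ N x u

/-- The order-preserving embedding of `{0,…,2N-3}` into `{0,…,2N-1}` skipping the
positions `j` and `j+1`; it realizes the relabeling used in `β/{j,j+1}` and `ẍ_j`. -/
def skipTwo {N : ℕ} (j : Fin (2 * N)) (i : Fin (2 * (N - 1))) : Fin (2 * N) :=
  if h : i.val < j.val then ⟨i.val, lt_trans h j.isLt⟩
  else ⟨i.val + 2, by have := i.isLt; omega⟩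


/-- The embedding `skipTwo` which skips the pair of points with index `m`. -/
def skipPair {n : ℕ} (m : Fin (n + 1)) (i : Fin (2 * n)) : Fin (2 * (n + 1)) :=
  skipTwo (idxA (n + 1) m) i

lemma skipPair_eq_succAbove {n : ℕ} (m : Fin (n + 1)) (i : Fin (2 * n)) :
    skipPair m i = (idxA (n + 1) m).succAbove
      (Fin.succAbove (n := 2 * n) ⟨2 * m.val, by omega⟩ i) := by
  have hm := m.isLt
  have hi := i.isLt
  ext
  by_cases h : i.val < 2 * m.val
  · simp [skipPair, skipTwo, idxA, Fin.succAbove, Fin.lt_def, h]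
  · have h' : ¬ (i.val + 1 < 2 * m.val) := by omega
    simp [skipPair, skipTwo, idxA, Fin.succAbove, Fin.lt_def, h, h']

lemma prod_eq_mul_prod_skipPair {M : Type*} [CommMonoid M] {n : ℕ} (m : Fin (n + 1))
    (f : Fin (2 * (n + 1)) → M) :
    ∏ i, f i = f (idxA (n + 1) m) * f (idxB (n + 1) m) *
      ∏ i : Fin (2 * n), f (skipPair m i) := by
  have hm := m.isLt
  have hB : (idxA (n + 1) m).succAbove (⟨2 * m.val, by omega⟩ : Fin (2 * n + 1)) =
      idxB (n + 1) m := by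
    ext
    simp [idxA, idxB, Fin.succAbove]
  simp_rw [skipPair_eq_succAbove]
  rw [← hB, mul_assoc, ← Fin.prod_univ_succAbove (n := 2 * n)
    (fun i => f ((idxA (n + 1) m).succAbove i)) ⟨2 * m.val, by omega⟩]
  exact Fin.prod_univ_succAbove (n := 2 * n + 1) f (idxA (n + 1) m)

lemma skipPair_strictMono {n : ℕ} (m : Fin (n + 1)) :
    StrictMono fun i : Fin (2 * n) => skipPair m i := by
  intro i k h
  simp only [skipPair_eq_succAbove]
  exact Fin.strictMono_succAbove _ (Fin.strictMono_succAbove _ h)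

lemma skipPair_lt_iff {n : ℕ} (m : Fin (n + 1)) (i k : Fin (2 * n)) :
    skipPair m i < skipPair m k ↔ i < k :=
  (skipPair_strictMono m).lt_iff_lt

lemma skipPair_cases {n : ℕ} (m : Fin (n + 1)) (i : Fin (2 * n)) :
    (skipPair m i < idxA (n + 1) m ∧
      skipPair m i < idxB (n + 1) m) ∨
    (idxA (n + 1) m < skipPair m i ∧
      idxB (n + 1) m < skipPair m i) := by
  by_cases h : i.val < 2 * m.val
  · left
    simp [skipPair, skipTwo, idxA, idxB, Fin.lt_def, h]
    omega
  · right
    simp [skipPair, skipTwo, idxA, idxB, Fin.lt_def, h]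
    omega

lemma idxA_lt_idxB {N : ℕ} (r : Fin N) : idxA N r < idxB N r := by
  simp [idxA, idxB, Fin.lt_def]

lemma idxA_succAbove {n : ℕ} (m : Fin (n + 1)) (r : Fin n) :
    idxA (n + 1) (m.succAbove r) = skipPair m (idxA n r) := by
  ext
  by_cases h : r.val < m.val
  · simp [skipPair, skipTwo, idxA, Fin.succAbove, Fin.lt_def, h]
  · simp [skipPair, skipTwo, idxA, Fin.succAbove, Fin.lt_def, h]
    ring

lemma idxB_succAbove {n : ℕ} (m : Fin (n + 1)) (r : Fin n) :
    idxB (n + 1) (m.succAbove r) = skipPair m (idxB n r) := by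
  ext
  by_cases h : r.val < m.val
  · have h' : 2 * r.val + 1 < 2 * m.val := by omega
    simp [skipPair, skipTwo, idxA, idxB, Fin.succAbove, Fin.lt_def, h, h']
  · have h' : ¬ (2 * r.val + 1 < 2 * m.val) := by omega
    simp [skipPair, skipTwo, idxA, idxB, Fin.succAbove, Fin.lt_def, h, h']
    ring

/-- The ordered product of powers of differences, split at the pair of points `m`. -/
lemma prod_sub_rpow_eq_mul_skipPair {n : ℕ} (m : Fin (n + 1)) (e : ℝ)
    {y : Fin (2 * (n + 1)) → ℝ} (hy : StrictMono y) :
    (∏ i, ∏ k, if i < k then (y k - y i) ^ e else 1) =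
      (y (idxB (n + 1) m) - y (idxA (n + 1) m)) ^ e *
      (∏ i : Fin (2 * n), |y (skipPair m i) - y (idxA (n + 1) m)| ^ e *
        |y (skipPair m i) - y (idxB (n + 1) m)| ^ e) *
      ∏ i : Fin (2 * n), ∏ k : Fin (2 * n), if i < k then
        (y (skipPair m k) - y (skipPair m i)) ^ e else 1 := by
  set A := idxA (n + 1) m
  set B := idxB (n + 1) m
  have hAB : A < B := idxA_lt_idxB m
  have key : ∀ i : Fin (2 * n),
      |y (skipPair m i) - y A| ^ e * |y (skipPair m i) - y B| ^ e =
      ((if A < skipPair m i then (y (skipPair m i) - y A) ^ e else 1) *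
        (if B < skipPair m i then (y (skipPair m i) - y B) ^ e else 1)) *
      ((if skipPair m i < A then (y A - y (skipPair m i)) ^ e else 1) *
        (if skipPair m i < B then (y B - y (skipPair m i)) ^ e else 1)) := by
    intro i
    rcases skipPair_cases m i with ⟨h1, h2⟩ | ⟨h1, h2⟩
    · rw [if_neg h1.not_gt, if_neg h2.not_gt, if_pos h1, if_pos h2,
        abs_of_neg (sub_neg.2 (hy h1)), abs_of_neg (sub_neg.2 (hy h2))]
      simp [A, B]
    · rw [if_neg h1.not_gt, if_neg h2.not_gt, if_pos h1, if_pos h2,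
        abs_of_pos (sub_pos.2 (hy h1)), abs_of_pos (sub_pos.2 (hy h2))]
      simp [A, B]
  simp_rw [key, prod_eq_mul_prod_skipPair m, Finset.prod_mul_distrib]
  simp only [A, B, skipPair_lt_iff] at hAB ⊢
  simp only [lt_irrefl, if_false, hAB, if_true, hAB.not_gt]
  ring

/-- The bounded part of the integrand which carries the dependence on the two merging points
`p.1`, `p.2` and on the integration variable `u` between them. -/
def cgKernel (κ : ℝ) {n : ℕ} (z : Fin (2 * n) → ℝ) (w : (ℝ × ℝ) × ℝ × (Fin n → ℝ)) : ℝ :=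
  (∏ r : Fin n, |w.2.1 - w.2.2 r| ^ (8 / κ) *
      (|w.2.2 r - w.1.1| ^ (-(4 / κ)) * |w.2.2 r - w.1.2| ^ (-(4 / κ)))) *
    ∏ i : Fin (2 * n), |w.2.1 - z i| ^ (-(4 / κ))

lemma cgIntegrand_insertNth (κ : ℝ) {n : ℕ} (m : Fin (n + 1)) (y : Fin (2 * (n + 1)) → ℝ)
    {u : ℝ} {v : Fin n → ℝ} (hlt : ∀ r, m.succAbove r < m → v r < u)
    (hgt : ∀ r, m < m.succAbove r → u < v r) :
    cgIntegrand κ (n + 1) y (m.insertNth u v) =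
      |u - y (idxA (n + 1) m)| ^ (-(4 / κ)) * |u - y (idxB (n + 1) m)| ^ (-(4 / κ)) *
      cgIntegrand κ n (fun i => y (skipPair m i)) v *
      cgKernel κ (fun i => y (skipPair m i))
        ((y (idxA (n + 1) m), y (idxB (n + 1) m)), u, v) := by
  have key : ∀ r : Fin n, |u - v r| ^ (8 / κ) =
      (if m < m.succAbove r then (v r - u) ^ (8 / κ) else 1) *
      (if m.succAbove r < m then (u - v r) ^ (8 / κ) else 1) := by
    intro r
    rcases lt_or_gt_of_ne (Fin.succAbove_ne m r) with h | h
    · rw [if_neg h.not_gt, if_pos h, abs_of_pos (sub_pos.2 (hlt r h)), one_mul]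
    · rw [if_neg h.not_gt, if_pos h, abs_of_neg (sub_neg.2 (hgt r h)), neg_sub, mul_one]
  unfold cgIntegrand cgKernel
  simp_rw [key, Fin.prod_univ_succAbove _ m, Finset.prod_mul_distrib, prod_eq_mul_prod_skipPair m,
    Finset.prod_mul_distrib]
  simp only [Fin.insertNth_apply_same, Fin.insertNth_apply_succAbove, lt_irrefl, if_false,
    (Fin.strictMono_succAbove m).lt_iff_lt, one_mul]
  ac_rfl

lemma integrableOn_rpow_mul_one_sub_rpow {p q : ℝ} (hp : -1 < p) (hq : -1 < q) :
    IntegrableOn (fun t : ℝ => |t| ^ p * |1 - t| ^ q) (Set.Ioo 0 1) := by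
  have h := Complex.betaIntegral_convergent (u := ((p + 1 : ℝ) : ℂ)) (v := ((q + 1 : ℝ) : ℂ))
    (by rw [Complex.ofReal_re]; linarith) (by rw [Complex.ofReal_re]; linarith)
  rw [intervalIntegrable_iff_integrableOn_Ioo_of_le zero_le_one] at h
  refine IntegrableOn.congr_fun h.norm (fun t ht => ?_) measurableSet_Ioo
  have h1 : (1 - t : ℂ) = ((1 - t : ℝ) : ℂ) := by push_cast; ring
  simp only [h1]
  rw [norm_mul, Complex.norm_cpow_eq_rpow_re_of_pos ht.1,
    Complex.norm_cpow_eq_rpow_re_of_pos (sub_pos.2 ht.2), abs_of_pos ht.1,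
    abs_of_pos (sub_pos.2 ht.2)]
  simp

lemma integral_rpow_mul_one_sub_rpow {p q : ℝ} (hp : -1 < p) (hq : -1 < q) :
    ∫ t in Set.Ioo (0 : ℝ) 1, |t| ^ p * |1 - t| ^ q =
      Real.Gamma (p + 1) * Real.Gamma (q + 1) / Real.Gamma (p + 1 + (q + 1)) := by
  change _ = ProbabilityTheory.beta (p + 1) (q + 1)
  rw [ProbabilityTheory.beta_eq_betaIntegralReal _ _ (by linarith) (by linarith),
    Complex.betaIntegral, intervalIntegral.integral_of_le zero_le_one, integral_Ioc_eq_integral_Ioo,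
    ← Complex.ofReal_re (∫ t in Set.Ioo (0 : ℝ) 1, |t| ^ p * |1 - t| ^ q), ← integral_complex_ofReal]
  congr 1
  refine setIntegral_congr_fun measurableSet_Ioo fun t ht => ?_
  have h1 : (1 - t : ℂ) = ((1 - t : ℝ) : ℂ) := by push_cast; ring
  simp only [h1]
  rw [abs_of_pos ht.1, abs_of_pos (sub_pos.2 ht.2), Complex.ofReal_mul,
    Complex.ofReal_cpow ht.1.le, Complex.ofReal_cpow (sub_pos.2 ht.2).le]
  simp

lemma integrableOn_abs_sub_rpow_mul_abs_sub_rpow {p q : ℝ} (hp : -1 < p) (hq : -1 < q) {c d : ℝ}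
    (hcd : c < d) :
    IntegrableOn (fun t : ℝ => |t - c| ^ p * |t - d| ^ q) (Set.Ioo c d) := by
  have hd : 0 < d - c := sub_pos.2 hcd
  have h := integrableOn_rpow_mul_one_sub_rpow hp hq
  rw [← intervalIntegrable_iff_integrableOn_Ioo_of_le zero_le_one] at h
  have h2 := (h.comp_mul_left (c := (d - c)⁻¹)).comp_sub_right c
  have e1 : 0 / (d - c)⁻¹ + c = c := by simp
  have e2 : 1 / (d - c)⁻¹ + c = d := by simp
  rw [e1, e2, intervalIntegrable_iff_integrableOn_Ioo_of_le hcd.le] at h2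
  have h3 := h2.const_mul ((d - c) ^ p * (d - c) ^ q)
  refine IntegrableOn.congr_fun h3 (fun t ht => ?_) measurableSet_Ioo
  have e3 : (d - c) * |(d - c)⁻¹ * (t - c)| = |t - c| := by
    rw [abs_mul, abs_of_pos (inv_pos.2 hd), mul_inv_cancel_left₀ hd.ne']
  have e4 : (d - c) * |1 - (d - c)⁻¹ * (t - c)| = |t - d| := by
    rw [abs_sub_comm t d, ← abs_of_pos hd, ← abs_mul, abs_of_pos hd, mul_sub,
      mul_inv_cancel_left₀ hd.ne']
    congr 1; ring
  rw [← e3, ← e4, Real.mul_rpow hd.le (abs_nonneg _), Real.mul_rpow hd.le (abs_nonneg _)]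
  ring

lemma measurable_cgIntegrand (κ : ℝ) (N : ℕ) (x : Fin (2 * N) → ℝ) :
    Measurable (cgIntegrand κ N x) := by
  unfold cgIntegrand
  refine Measurable.mul ?_ (by fun_prop)
  refine Finset.measurable_prod _ fun r _ => Finset.measurable_prod _ fun s _ => ?_
  split_ifs <;> fun_prop

lemma measurable_cgKernel (κ : ℝ) {n : ℕ} (z : Fin (2 * n) → ℝ) : Measurable (cgKernel κ z) := by
  unfold cgKernel
  fun_prop

lemma measurableSet_cgBox (N : ℕ) (x : Fin (2 * N) → ℝ) : MeasurableSet (cgBox N x) :=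
  MeasurableSet.univ_pi fun _ => measurableSet_Ioo

/-- The Coulomb gas integrand is integrable over the box. -/
lemma integrableOn_cgIntegrand {κ : ℝ} (hκ : 4 < κ) {N : ℕ} {x : Fin (2 * N) → ℝ}
    (hx : StrictMono x) : IntegrableOn (cgIntegrand κ N x) (cgBox N x) := by
  have hκ0 : 0 < κ := by linarith
  have hp : -1 < -(4 / κ) := by
    rw [neg_lt_neg_iff, div_lt_one hκ0]; exact hκ
  have hAB : ∀ r, idxB N r ≠ idxA N r := fun r => (idxA_lt_idxB r).ne'
  set I : Fin N → Finset (Fin (2 * N)) := fun r => (Finset.univ.erase (idxA N r)).erase (idxB N r)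
  set g : (Fin N → ℝ) → ℝ := fun u =>
    (∏ r : Fin N, ∏ s : Fin N, if r < s then (u s - u r) ^ (8 / κ) else 1) *
      ∏ r : Fin N, ∏ i ∈ I r, |u r - x i| ^ (-(4 / κ))
  set K : Set (Fin N → ℝ) := Set.univ.pi fun r => Set.Icc (x (idxA N r)) (x (idxB N r))
  have hK : IsCompact K := isCompact_univ_pi fun r => isCompact_Icc
  have hsub : cgBox N x ⊆ K := Set.pi_mono fun r _ => Set.Ioo_subset_Icc_self
  have hg : ContinuousOn g K := by
    refine ContinuousOn.mul ?_ ?_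
    · refine continuousOn_finsetProd _ fun r _ => continuousOn_finsetProd _ fun s _ => ?_
      split_ifs
      · refine ContinuousOn.rpow_const (by fun_prop) fun u _ => Or.inr (by positivity)
      · exact continuousOn_const
    · refine continuousOn_finsetProd _ fun r _ => continuousOn_finsetProd _ fun i hi => ?_
      refine ContinuousOn.rpow_const (by fun_prop) fun u hu => Or.inl ?_
      rw [abs_ne_zero, sub_ne_zero]
      have hur := hu r (Set.mem_univ r)
      have hiB : i ≠ idxB N r := by simp [I] at hi; tauto
      have hiA : i ≠ idxA N r := by simp [I] at hi; tauto
      rintro h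
      rw [h, Set.mem_Icc, hx.le_iff_le, hx.le_iff_le, Fin.le_def, Fin.le_def] at hur
      rw [Ne, Fin.ext_iff] at hiA hiB
      simp only [idxA, idxB] at hur hiA hiB
      omega
  have hf : IntegrableOn (fun u : Fin N → ℝ => ∏ r,
      (|u r - x (idxA N r)| ^ (-(4 / κ)) * |u r - x (idxB N r)| ^ (-(4 / κ)))) (cgBox N x) := by
    have := Integrable.fintype_prod (μ := fun r : Fin N =>
        volume.restrict (Set.Ioo (x (idxA N r)) (x (idxB N r))))
      (f := fun (r : Fin N) (t : ℝ) =>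
        |t - x (idxA N r)| ^ (-(4 / κ)) * |t - x (idxB N r)| ^ (-(4 / κ)))
      (fun r => integrableOn_abs_sub_rpow_mul_abs_sub_rpow hp hp (hx (idxA_lt_idxB r)))
    rwa [← Measure.restrict_pi_pi] at this
  have := hf.mul_continuousOn_of_subset hg (measurableSet_cgBox N x) hK hsub
  refine this.congr_fun (fun u _ => ?_) (measurableSet_cgBox N x)
  have hI : ∀ r : Fin N, ∏ i, |u r - x i| ^ (-(4 / κ)) =
      |u r - x (idxA N r)| ^ (-(4 / κ)) * |u r - x (idxB N r)| ^ (-(4 / κ)) *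
        ∏ i ∈ I r, |u r - x i| ^ (-(4 / κ)) := by
    intro r
    rw [mul_assoc, Finset.mul_prod_erase _ (fun i => |u r - x i| ^ (-(4 / κ)))
      (Finset.mem_erase.2 ⟨hAB r, Finset.mem_univ _⟩),
      Finset.mul_prod_erase _ (fun i => |u r - x i| ^ (-(4 / κ))) (Finset.mem_univ _)]
  simp only [cgIntegrand, g, hI, Finset.prod_mul_distrib]
  ac_rfl

lemma setIntegral_Ioo_prod_affine {X : Type*} [MeasurableSpace X] (ν : Measure X) [SFinite ν]
    (F : ℝ × X → ℝ) {a b : ℝ} (hab : a < b) (s : Set X) :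
    ∫ w in Set.Ioo a b ×ˢ s, F w ∂(volume.prod ν) =
      ∫ w in Set.Ioo 0 1 ×ˢ s, (b - a) * F (a + (b - a) * w.1, w.2) ∂(volume.prod ν) := by
  have hba : 0 < b - a := sub_pos.2 hab
  let e : ℝ ≃ᵐ ℝ :=
    ((Homeomorph.mulLeft₀ (b - a) hba.ne').trans (Homeomorph.addLeft a)).toMeasurableEquiv
  have he : ∀ t, e t = a + (b - a) * t := fun t => rfl
  let φ : ℝ × X ≃ᵐ ℝ × X := e.prodCongr (MeasurableEquiv.refl X)
  have hφ : ∀ w, φ w = (a + (b - a) * w.1, w.2) := fun w => rfl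
  have hmap : Measure.map e volume = ENNReal.ofReal (b - a)⁻¹ • (volume : Measure ℝ) := by
    have h1 : (e : ℝ → ℝ) = (fun t => a + t) ∘ ((b - a) * ·) := rfl
    rw [h1, ← Measure.map_map (by fun_prop) (by fun_prop), Real.map_volume_mul_left hba.ne',
      Measure.map_smul, (measurePreserving_add_left volume a).map_eq,
      abs_of_pos (inv_pos.2 hba)]
  have hmap' : Measure.map φ (volume.prod ν) =
      ENNReal.ofReal (b - a)⁻¹ • ((volume : Measure ℝ).prod ν) := by
    have h2 : (φ : ℝ × X → ℝ × X) = Prod.map e id := rfl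
    rw [h2, ← Measure.map_prod_map _ _ e.measurable measurable_id, hmap, Measure.map_id,
      Measure.prod_smul_left]
  have hpre : φ ⁻¹' (Set.Ioo a b ×ˢ s) = Set.Ioo 0 1 ×ˢ s := by
    ext w
    simp only [Set.mem_preimage, hφ, Set.mem_prod, Set.mem_Ioo]
    refine and_congr_left fun _ => and_congr ?_ ?_
    · rw [lt_add_iff_pos_right, mul_pos_iff_of_pos_left hba]
    · constructor <;> intro h <;> nlinarith
  have h3 := setIntegral_map_equiv φ F (Set.Ioo a b ×ˢ s) (μ := (volume : Measure ℝ).prod ν)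
  rw [hmap', hpre, Measure.restrict_smul, integral_smul_measure,
    ENNReal.toReal_ofReal (inv_pos.2 hba).le, smul_eq_mul] at h3
  rw [integral_const_mul]
  simp only [hφ] at h3
  rw [← h3, mul_inv_cancel_left₀ hba.ne']

/-- Fubini for the box, with the coordinate of the pair `m` rescaled to the unit interval. -/
lemma setIntegral_cgBox_succ {n : ℕ} (m : Fin (n + 1)) (y : Fin (2 * (n + 1)) → ℝ)
    (hab : y (idxA (n + 1) m) < y (idxB (n + 1) m)) (F : (Fin (n + 1) → ℝ) → ℝ) :
    ∫ u in cgBox (n + 1) y, F u =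
      ∫ w in Set.Ioo (0 : ℝ) 1 ×ˢ cgBox n (fun i => y (skipPair m i)),
        (y (idxB (n + 1) m) - y (idxA (n + 1) m)) *
          F (m.insertNth (y (idxA (n + 1) m) +
            (y (idxB (n + 1) m) - y (idxA (n + 1) m)) * w.1) w.2) := by
  rw [Measure.volume_eq_prod, ← setIntegral_Ioo_prod_affine volume
    (fun w : ℝ × (Fin n → ℝ) => F (m.insertNth w.1 w.2)) hab, ← Measure.volume_eq_prod,
    ← ((volume_preserving_piFinSuccAbove (fun _ : Fin (n + 1) => ℝ) m).symm _
      ).setIntegral_preimage_emb (MeasurableEquiv.measurableEmbedding _)]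
  congr 2
  ext w
  simp [cgBox, MeasurableEquiv.piFinSuccAbove_symm_apply, Fin.forall_iff_succAbove m,
    idxA_succAbove, idxB_succAbove, Set.mem_pi]

lemma exists_pos_forall_notMem_Icc {n : ℕ} {z : Fin (2 * n) → ℝ} {ξ : ℝ}
    (hpair : ∀ r, z (idxB n r) < ξ ∨ ξ < z (idxA n r)) (hne : ∀ i, z i ≠ ξ) :
    ∃ δ > 0, (∀ t ∈ Set.Icc (ξ - δ) (ξ + δ), ∀ i, t ≠ z i) ∧
      ∀ t ∈ Set.Icc (ξ - δ) (ξ + δ), ∀ r, t ∉ Set.Icc (z (idxA n r)) (z (idxB n r)) := by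
  have h : ∀ᶠ δ in 𝓝[>] (0 : ℝ), ∀ i, δ < |z i - ξ| :=
    Filter.eventually_all.2 fun i =>
      mem_nhdsWithin_of_mem_nhds (Iio_mem_nhds (abs_pos.2 (sub_ne_zero.2 (hne i))))
  obtain ⟨δ, hδ, hδ0⟩ := (h.and self_mem_nhdsWithin).exists
  refine ⟨δ, hδ0, fun t ht i hti => ?_, fun t ht r hr => ?_⟩
  · have := hδ i
    rw [← hti, lt_abs] at this
    rcases this with h | h <;> linarith [ht.1, ht.2]
  · rcases hpair r with h | h
    · have := hδ (idxB n r)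
      rw [abs_of_neg (sub_neg.2 h)] at this
      linarith [ht.1, hr.2]
    · have := hδ (idxA n r)
      rw [abs_of_pos (sub_pos.2 h)] at this
      linarith [ht.2, hr.1]

lemma tendsto_integral_cgKernel {κ : ℝ} (hκ : 4 < κ) {n : ℕ} {z : Fin (2 * n) → ℝ}
    (hz : StrictMono z) {ξ : ℝ} (hpair : ∀ r, z (idxB n r) < ξ ∨ ξ < z (idxA n r))
    (hne : ∀ i, z i ≠ ξ) :
    Tendsto (fun p : ℝ × ℝ => ∫ w in Set.Ioo (0 : ℝ) 1 ×ˢ cgBox n z,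
        (|w.1| ^ (-(4 / κ)) * |1 - w.1| ^ (-(4 / κ)) * cgIntegrand κ n z w.2) *
          cgKernel κ z (p, p.1 + (p.2 - p.1) * w.1, w.2))
      (𝓝 (ξ, ξ))
      (𝓝 ((∫ t in Set.Ioo (0 : ℝ) 1, |t| ^ (-(4 / κ)) * |1 - t| ^ (-(4 / κ))) *
        (∫ v in cgBox n z, cgIntegrand κ n z v) * ∏ i, |z i - ξ| ^ (-(4 / κ)))) := by
  have hκ0 : 0 < κ := by linarith
  have hp : -1 < -(4 / κ) := by
    rw [neg_lt_neg_iff, div_lt_one hκ0]; exact hκ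
  obtain ⟨δ, hδ, hδz, hδI⟩ := exists_pos_forall_notMem_Icc hpair hne
  set J := Set.Icc (ξ - δ) (ξ + δ)
  set K : Set (Fin n → ℝ) := Set.univ.pi fun r => Set.Icc (z (idxA n r)) (z (idxB n r))
  set C : Set ((ℝ × ℝ) × ℝ × (Fin n → ℝ)) := (J ×ˢ J) ×ˢ J ×ˢ K
  have hC : IsCompact C := (isCompact_Icc.prod isCompact_Icc).prod
    (isCompact_Icc.prod (isCompact_univ_pi fun r => isCompact_Icc))
  have hsub : cgBox n z ⊆ K := Set.pi_mono fun r _ => Set.Ioo_subset_Icc_self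
  have hcont : ContinuousOn (cgKernel κ z) C := by
    have hout : ∀ w ∈ C, ∀ r, ∀ t ∈ J, w.2.2 r ≠ t := fun w hw r t ht h =>
      hδI t ht r (h ▸ hw.2.2 r (Set.mem_univ r))
    refine ContinuousOn.mul (continuousOn_finsetProd _ fun r _ => ?_)
      (continuousOn_finsetProd _ fun i _ => ?_)
    · refine ContinuousOn.mul ?_ (ContinuousOn.mul ?_ ?_)
      · exact ContinuousOn.rpow_const (by fun_prop) fun u _ => Or.inr (by positivity)
      · refine ContinuousOn.rpow_const (by fun_prop) fun w hw => Or.inl ?_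
        exact abs_ne_zero.2 (sub_ne_zero.2 (hout w hw r _ hw.1.1))
      · refine ContinuousOn.rpow_const (by fun_prop) fun w hw => Or.inl ?_
        exact abs_ne_zero.2 (sub_ne_zero.2 (hout w hw r _ hw.1.2))
    · refine ContinuousOn.rpow_const (by fun_prop) fun w hw => Or.inl ?_
      exact abs_ne_zero.2 (sub_ne_zero.2 (hδz _ hw.2.1 i))
  obtain ⟨M, hM⟩ := hC.exists_bound_of_continuousOn hcont
  have hJ : J ∈ 𝓝 ξ := Icc_mem_nhds (by linarith) (by linarith)
  have hmem : ∀ᶠ p in 𝓝 (ξ, ξ), ∀ w ∈ Set.Ioo (0 : ℝ) 1 ×ˢ cgBox n z,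
      ((p, p.1 + (p.2 - p.1) * w.1, w.2) : (ℝ × ℝ) × ℝ × (Fin n → ℝ)) ∈ C := by
    filter_upwards [prod_mem_nhds hJ hJ] with p hpJ w hw
    refine ⟨hpJ, ?_, hsub hw.2⟩
    have := (convex_Icc (ξ - δ) (ξ + δ)) hpJ.1 hpJ.2 (sub_nonneg.2 hw.1.2.le) hw.1.1.le (by ring)
    simp only [smul_eq_mul] at this
    convert! this using 1
    ring
  have hS : MeasurableSet (Set.Ioo (0 : ℝ) 1 ×ˢ cgBox n z) :=
    measurableSet_Ioo.prod (measurableSet_cgBox n z)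
  have hf : IntegrableOn (fun w : ℝ × (Fin n → ℝ) =>
      |w.1| ^ (-(4 / κ)) * |1 - w.1| ^ (-(4 / κ)) * cgIntegrand κ n z w.2)
      (Set.Ioo (0 : ℝ) 1 ×ˢ cgBox n z) := by
    have := Integrable.mul_prod (integrableOn_rpow_mul_one_sub_rpow hp hp)
      (integrableOn_cgIntegrand hκ hz)
    rwa [Measure.prod_restrict] at this
  have hmeas := measurable_cgIntegrand κ n z
  have hlim : (∫ t in Set.Ioo (0 : ℝ) 1, |t| ^ (-(4 / κ)) * |1 - t| ^ (-(4 / κ))) *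
      (∫ v in cgBox n z, cgIntegrand κ n z v) * ∏ i, |z i - ξ| ^ (-(4 / κ)) =
      ∫ w in Set.Ioo (0 : ℝ) 1 ×ˢ cgBox n z,
        (|w.1| ^ (-(4 / κ)) * |1 - w.1| ^ (-(4 / κ)) * cgIntegrand κ n z w.2) *
          ∏ i, |z i - ξ| ^ (-(4 / κ)) := by
    rw [integral_mul_const, Measure.volume_eq_prod,
      setIntegral_prod_mul (fun t : ℝ => |t| ^ (-(4 / κ)) * |1 - t| ^ (-(4 / κ)))]
  rw [hlim]
  refine tendsto_integral_filter_of_dominated_convergence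
    (fun w => ‖|w.1| ^ (-(4 / κ)) * |1 - w.1| ^ (-(4 / κ)) * cgIntegrand κ n z w.2‖ * M)
    ?_ ?_ (hf.norm.mul_const M) ?_
  · refine Eventually.of_forall fun p => Measurable.aestronglyMeasurable ?_
    refine Measurable.mul (by fun_prop) ((measurable_cgKernel κ z).comp ?_)
    fun_prop
  · filter_upwards [hmem] with p hpC
    refine ae_restrict_of_forall_mem hS fun w hw => ?_
    rw [norm_mul]
    exact mul_le_mul_of_nonneg_left (hM _ (hpC w hw)) (norm_nonneg _)
  · refine ae_restrict_of_forall_mem hS fun w hw => Tendsto.const_mul _ ?_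
    have h0 : ((ξ, ξ), ξ, w.2) ∈ C := by
      have := hmem.self_of_nhds w hw
      simpa using this
    have hval : cgKernel κ z ((ξ, ξ), ξ, w.2) = ∏ i, |z i - ξ| ^ (-(4 / κ)) := by
      have h1 : ∀ r, |ξ - w.2 r| ^ (8 / κ) *
          (|w.2 r - ξ| ^ (-(4 / κ)) * |w.2 r - ξ| ^ (-(4 / κ))) = 1 := by
        intro r
        have hpos : 0 < |w.2 r - ξ| := by
          refine abs_pos.2 (sub_ne_zero.2 fun h => ?_)
          exact hδI ξ (mem_of_mem_nhds hJ) r (h ▸ h0.2.2 r (Set.mem_univ r))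
        rw [abs_sub_comm, ← Real.rpow_add hpos, ← Real.rpow_add hpos]
        convert Real.rpow_zero _ using 2
        ring
      simp only [cgKernel, h1, Finset.prod_const_one, one_mul]
      simp only [abs_sub_comm ξ]
    rw [← hval]
    refine (hcont _ h0).tendsto.comp (tendsto_nhdsWithin_iff.2 ⟨?_, ?_⟩)
    · refine tendsto_id.prodMk_nhds (Tendsto.prodMk_nhds ?_ tendsto_const_nhds)
      have : Continuous fun p : ℝ × ℝ => p.1 + (p.2 - p.1) * w.1 := by fun_prop
      simpa using this.tendsto (ξ, ξ)
    · filter_upwards [hmem] with p hpC using hpC w hw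

/-- Exact factorization of `cgG` near the pair `m`. -/
lemma cgG_succ_div {κ : ℝ} (hκ : 4 < κ) {n : ℕ} (m : Fin (n + 1)) {y : Fin (2 * (n + 1)) → ℝ}
    (hy : StrictMono y) :
    cgG κ (n + 1) y / (y (idxB (n + 1) m) - y (idxA (n + 1) m)) ^ (-(2 * hexp κ)) =
      cgConst κ ^ (n + 1) *
      ((∏ i : Fin (2 * n), |y (skipPair m i) - y (idxA (n + 1) m)| ^ (2 / κ) *
        |y (skipPair m i) - y (idxB (n + 1) m)| ^ (2 / κ)) *
      ∏ i : Fin (2 * n), ∏ k : Fin (2 * n), if i < k then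
        (y (skipPair m k) - y (skipPair m i)) ^ (2 / κ) else 1) *
      ∫ w in Set.Ioo (0 : ℝ) 1 ×ˢ cgBox n (fun i => y (skipPair m i)),
        (|w.1| ^ (-(4 / κ)) * |1 - w.1| ^ (-(4 / κ)) *
          cgIntegrand κ n (fun i => y (skipPair m i)) w.2) *
        cgKernel κ (fun i => y (skipPair m i)) ((y (idxA (n + 1) m), y (idxB (n + 1) m)),
          y (idxA (n + 1) m) + (y (idxB (n + 1) m) - y (idxA (n + 1) m)) * w.1, w.2) := by
  have hκ0 : 0 < κ := by linarith
  have hab : y (idxA (n + 1) m) < y (idxB (n + 1) m) := hy (idxA_lt_idxB m)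
  unfold cgG
  rw [prod_sub_rpow_eq_mul_skipPair m _ hy, setIntegral_cgBox_succ m y hab]
  set a := y (idxA (n + 1) m) with ha
  set b := y (idxB (n + 1) m) with hb
  have hba : 0 < b - a := sub_pos.2 hab
  rw [setIntegral_congr_fun (g := fun w : ℝ × (Fin n → ℝ) =>
    ((b - a) * ((b - a) ^ (-(4 / κ)) * (b - a) ^ (-(4 / κ)))) *
    ((|w.1| ^ (-(4 / κ)) * |1 - w.1| ^ (-(4 / κ)) *
          cgIntegrand κ n (fun i => y (skipPair m i)) w.2) *
        cgKernel κ (fun i => y (skipPair m i)) ((a, b), a + (b - a) * w.1, w.2)))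
      (measurableSet_Ioo.prod (measurableSet_cgBox n _)) ?_, integral_const_mul]
  · have hpow : (b - a) ^ (2 / κ) * ((b - a) * ((b - a) ^ (-(4 / κ)) * (b - a) ^ (-(4 / κ)))) =
        (b - a) ^ (-(2 * hexp κ)) := by
      nth_rw 2 [← Real.rpow_one (b - a)]
      rw [← Real.rpow_add hba, ← Real.rpow_add hba, ← Real.rpow_add hba]
      congr 1
      unfold hexp
      field_simp
      ring
    rw [div_eq_iff (Real.rpow_pos_of_pos hba _).ne', ← hpow]
    ac_rfl
  · intro w hw
    have hu1 : a < a + (b - a) * w.1 := by nlinarith [mul_pos hba hw.1.1]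
    have hu2 : a + (b - a) * w.1 < b := by nlinarith [mul_pos hba (sub_pos.2 hw.1.2)]
    have hv : ∀ r, y (skipPair m (idxA n r)) < w.2 r ∧ w.2 r < y (skipPair m (idxB n r)) :=
      fun r => hw.2 r (Set.mem_univ r)
    have e1 : |a + (b - a) * w.1 - a| = (b - a) * |w.1| := by
      rw [← abs_of_pos hba, ← abs_mul, abs_of_pos hba]; congr 1; ring
    have e2 : |a + (b - a) * w.1 - b| = (b - a) * |1 - w.1| := by
      rw [← abs_of_pos hba, ← abs_mul, abs_of_pos hba, ← abs_neg]; congr 1; ring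
    simp only
    rw [cgIntegrand_insertNth, ← ha, ← hb, e1, e2, Real.mul_rpow hba.le (abs_nonneg _),
      Real.mul_rpow hba.le (abs_nonneg _)]
    · ring
    · intro r hr
      refine ((hv r).2.trans (hy ?_)).trans hu1
      rw [← idxB_succAbove]
      simp only [idxA, idxB, Fin.lt_def] at hr ⊢
      omega
    · intro r hr
      refine hu2.trans (lt_trans (hy ?_) (hv r).1)
      rw [← idxA_succAbove]
      simp only [idxA, idxB, Fin.lt_def] at hr ⊢
      omega

lemma cgConst_mul_integral {κ : ℝ} (hκ : 4 < κ) :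
    cgConst κ * ∫ t in Set.Ioo (0 : ℝ) 1, |t| ^ (-(4 / κ)) * |1 - t| ^ (-(4 / κ)) =
      Real.sqrt (qexp κ) := by
  have hκ0 : 0 < κ := by linarith
  have h1 : 4 / κ < 1 := by rw [div_lt_one hκ0]; exact hκ
  rw [integral_rpow_mul_one_sub_rpow (by linarith) (by linarith), cgConst]
  have e1 : -(4 / κ) + 1 = 1 - 4 / κ := by ring
  have e2 : 1 - 4 / κ + (1 - 4 / κ) = 2 - 8 / κ := by ring
  rw [e1, e2]
  have g1 : Real.Gamma (1 - 4 / κ) ≠ 0 := (Real.Gamma_pos_of_pos (by linarith)).ne'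
  have g2 : Real.Gamma (2 - 8 / κ) ≠ 0 :=
    (Real.Gamma_pos_of_pos (by rw [← e2]; linarith)).ne'
  generalize Real.Gamma (1 - 4 / κ) = g at *
  generalize Real.Gamma (2 - 8 / κ) = g' at *
  field_simp

/-- asymptotics of `G^{(N)}` as `x_j, x_{j+1} → ξ` for an odd index `j`
(in 1-indexing; `j.val` even in 0-indexing, so that `{j, j+1}` is a link of `⌢⌢^{(N)}`):
the renormalized value tends to `√(q(κ)) · G^{(N-1)}(ẍ_j)`. -/
theorem cg_asymptotics (κ : ℝ) (hκ₁ : 4 < κ) (hκ₂ : κ < 8) (N : ℕ) (hN : 1 ≤ N)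
    (j : Fin (2 * N)) (hjodd : j.val % 2 = 0) (hj : j.val + 1 < 2 * N)
    (x : Fin (2 * N) → ℝ) (ξ : ℝ)
    (hx : ∀ i i' : Fin (2 * N), i < i' →
      i.val ≠ j.val → i.val ≠ j.val + 1 → i'.val ≠ j.val → i'.val ≠ j.val + 1 → x i < x i')
    (hlo : ∀ i : Fin (2 * N), i.val < j.val → x i < ξ)
    (hhi : ∀ i : Fin (2 * N), j.val + 1 < i.val → ξ < x i) :
    Tendsto
      (fun p : ℝ × ℝ =>
        cgG κ N (Function.update (Function.update x j p.1) ⟨j.val + 1, hj⟩ p.2)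
          / (p.2 - p.1) ^ (-(2 * hexp κ)))
      (𝓝[{p : ℝ × ℝ |
          StrictMono (Function.update (Function.update x j p.1) ⟨j.val + 1, hj⟩ p.2)}] (ξ, ξ))
      (𝓝 (Real.sqrt (qexp κ) * cgG κ (N - 1) fun i => x (skipTwo j i))) := by
  obtain ⟨n, rfl⟩ : ∃ n, N = n + 1 := ⟨N - 1, by omega⟩
  obtain ⟨m, rfl⟩ : ∃ m : Fin (n + 1), j = idxA (n + 1) m :=
    ⟨⟨j.val / 2, by omega⟩, by ext; simp only [idxA]; omega⟩
  change Tendsto (fun p : ℝ × ℝ => cgG κ (n + 1)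
      (Function.update (Function.update x (idxA (n + 1) m) p.1) (idxB (n + 1) m) p.2)
        / (p.2 - p.1) ^ (-(2 * hexp κ)))
    (𝓝[{p : ℝ × ℝ | StrictMono (Function.update (Function.update x (idxA (n + 1) m) p.1)
      (idxB (n + 1) m) p.2)}] (ξ, ξ))
    (𝓝 (Real.sqrt (qexp κ) * cgG κ n fun i => x (skipPair m i)))
  have hAB : idxA (n + 1) m ≠ idxB (n + 1) m := (idxA_lt_idxB m).ne
  have hsA : ∀ i, skipPair m i ≠ idxA (n + 1) m := fun i => by
    rcases skipPair_cases m i with h | h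
    exacts [h.1.ne, h.1.ne']
  have hsB : ∀ i, skipPair m i ≠ idxB (n + 1) m := fun i => by
    rcases skipPair_cases m i with h | h
    exacts [h.2.ne, h.2.ne']
  set z : Fin (2 * n) → ℝ := fun i => x (skipPair m i) with hz_def
  have hz : StrictMono z := fun i k hik => hx _ _ (skipPair_strictMono m hik)
    (Fin.val_ne_of_ne (hsA i)) (Fin.val_ne_of_ne (hsB i))
    (Fin.val_ne_of_ne (hsA k)) (Fin.val_ne_of_ne (hsB k))
  have hne : ∀ i, z i ≠ ξ := fun i => by
    rcases skipPair_cases m i with h | h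
    exacts [(hlo _ h.1).ne, (hhi _ h.2).ne']
  have hpair : ∀ r, z (idxB n r) < ξ ∨ ξ < z (idxA n r) := fun r => by
    rcases lt_or_gt_of_ne (Fin.succAbove_ne m r) with h | h
    · left
      refine hlo _ ?_
      rw [← idxB_succAbove]
      simp only [idxA, idxB, Fin.lt_def] at h ⊢
      omega
    · right
      refine hhi _ ?_
      rw [← idxA_succAbove]
      simp only [idxA, Fin.lt_def] at h ⊢
      omega
  have hlim := tendsto_integral_cgKernel hκ₁ hz hpair hne
  have hprod : Tendsto (fun p : ℝ × ℝ => ∏ i, |z i - p.1| ^ (2 / κ) * |z i - p.2| ^ (2 / κ))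
      (𝓝 (ξ, ξ)) (𝓝 (∏ i, |z i - ξ| ^ (4 / κ))) := by
    have he : 0 ≤ 2 / κ := div_nonneg zero_le_two (by linarith)
    have hc : Continuous fun p : ℝ × ℝ =>
        ∏ i, |z i - p.1| ^ (2 / κ) * |z i - p.2| ^ (2 / κ) :=
      continuous_finsetProd _ fun i _ =>
        (Continuous.rpow_const (by fun_prop) fun _ => Or.inr he).mul
          (Continuous.rpow_const (by fun_prop) fun _ => Or.inr he)
    convert! hc.tendsto (ξ, ξ) using 3 with i
    rw [← Real.rpow_add (abs_pos.2 (sub_ne_zero.2 (hne i)))]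
    congr 1
    ring
  have hcancel : (∏ i, |z i - ξ| ^ (4 / κ)) * ∏ i, |z i - ξ| ^ (-(4 / κ)) = 1 := by
    rw [← Finset.prod_mul_distrib]
    refine Finset.prod_eq_one fun i _ => ?_
    rw [← Real.rpow_add (abs_pos.2 (sub_ne_zero.2 (hne i))), add_neg_cancel, Real.rpow_zero]
  set V : ℝ := ∏ i : Fin (2 * n), ∏ k : Fin (2 * n), if i < k then (z k - z i) ^ (2 / κ) else 1
    with hV
  have htend := (((hprod.mul_const V).const_mul (cgConst κ ^ (n + 1))).mul hlim).mono_left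
    (nhdsWithin_le_nhds (s := {p : ℝ × ℝ | StrictMono (Function.update
      (Function.update x (idxA (n + 1) m) p.1) (idxB (n + 1) m) p.2)}))
  have hval : Real.sqrt (qexp κ) * cgG κ n z = cgConst κ ^ (n + 1) *
      ((∏ i, |z i - ξ| ^ (4 / κ)) * V) *
      ((∫ t in Set.Ioo (0 : ℝ) 1, |t| ^ (-(4 / κ)) * |1 - t| ^ (-(4 / κ))) *
        (∫ v in cgBox n z, cgIntegrand κ n z v) * ∏ i, |z i - ξ| ^ (-(4 / κ))) := by
    rw [← cgConst_mul_integral hκ₁, cgG, ← hV]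
    linear_combination (-(cgConst κ ^ (n + 1) * V *
      (∫ t in Set.Ioo (0 : ℝ) 1, |t| ^ (-(4 / κ)) * |1 - t| ^ (-(4 / κ))) *
      ∫ v in cgBox n z, cgIntegrand κ n z v)) * hcancel
  rw [hval]
  refine htend.congr' ?_
  filter_upwards [self_mem_nhdsWithin] with p hp
  have h := cgG_succ_div hκ₁ m hp
  have hyz : ∀ i, Function.update (Function.update x (idxA (n + 1) m) p.1)
      (idxB (n + 1) m) p.2 (skipPair m i) = z i := fun i => by
    rw [Function.update_of_ne (hsB i), Function.update_of_ne (hsA i)]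
  simp only [hyz, Function.update_self, Function.update_of_ne hAB] at h
  exact h.symm
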